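/- arXiv:1610.03664 — 3 statements merged into one kernel-verified Lean document; each statement's English description precedes it below -/
import Mathlib

section
/- Let ℓ₁,ℓ₂,ℓ₃ be linear forms on ℝⁿ with ℓᵢ(x)=aᵢᵀx, J a skew-symmetric real n×n matrix, a,b,c∈ℝ, and f(x)=J( a ℓ₂ℓ₃ a₁ + b ℓ₁ℓ₃ a₂ + c ℓ₁ℓ₂ a₃ ). Suppose x,x̃∈ℝⁿ satisfy the Kahan–Hirota–Kimura relation x̃−x = εJ( a(ℓ₂(x)ℓ₃(x̃)+ℓ₂(x̃)ℓ₃(x)) a₁ + b(ℓ₁(x)ℓ₃(x̃)+ℓ₁(x̃)ℓ₃(x)) a₂ + c(ℓ₁(x)ℓ₂(x̃)+ℓ₁(x̃)ℓ₂(x)) a₃ ). Then det(I+εf'(x̃)) · ℓ₁(x)ℓ₂(x)ℓ₃(x) = det(I−εf'(x)) · ℓ₁(x̃)ℓ₂(x̃)ℓ₃(x̃), where f'(x) is the Jacobian matrix of f. Consequently the Jacobian determinant of the Kahan–Hirota–Kimura map equals ℓ₁(x̃)ℓ₂(x̃)ℓ₃(x̃)/(ℓ₁(x)ℓ₂(x)ℓ₃(x)),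 i.e. the map preserves the measure form dx₁∧…∧dxₙ/(ℓ₁ℓ₂ℓ₃). -/
open Matrix

/-- The Jacobian matrix of a vector field `f : ℝⁿ → ℝⁿ` at a point `x`. -/
noncomputable def jacobian {n : ℕ} (f : (Fin n → ℝ) → (Fin n → ℝ)) (x : Fin n → ℝ) :
    Matrix (Fin n) (Fin n) ℝ :=
  Matrix.of fun i j => fderiv ℝ (fun y => f y i) x (Pi.single j 1)

/-- The coefficient matrix, in the basis of gradients, of the derivative of
`y ↦ (a y₂ y₃, b y₁ y₃, c y₁ y₂)`. -/
def nahmHessian (a b c : ℝ) (y : Fin 3 → ℝ) : Matrix (Fin 3) (Fin 3) ℝ :=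
  !![0, a * y 2, a * y 1; b * y 2, 0, b * y 0; c * y 1, c * y 0, 0]

theorem hasFDerivAt_dotProduct {n : ℕ} (v x : Fin n → ℝ) :
    HasFDerivAt (fun y => v ⬝ᵥ y)
      (LinearMap.toContinuousLinearMap (dotProductBilin ℝ ℝ v)) x :=
  (LinearMap.toContinuousLinearMap (dotProductBilin ℝ ℝ v)).hasFDerivAt

theorem jacobian_nahm {n : ℕ} (a₁ a₂ a₃ : Fin n → ℝ) (J : Matrix (Fin n) (Fin n) ℝ)
    (a b c : ℝ) (x : Fin n → ℝ) :
    jacobian (fun x => J *ᵥ ((a * (a₂ ⬝ᵥ x) * (a₃ ⬝ᵥ x)) • a₁ +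
      (b * (a₁ ⬝ᵥ x) * (a₃ ⬝ᵥ x)) • a₂ + (c * (a₁ ⬝ᵥ x) * (a₂ ⬝ᵥ x)) • a₃)) x =
    J * (of ![a₁, a₂, a₃])ᵀ * nahmHessian a b c (of ![a₁, a₂, a₃] *ᵥ x) *
      of ![a₁, a₂, a₃] := by
  ext i j
  have h₁ := hasFDerivAt_dotProduct a₁ x
  have h₂ := hasFDerivAt_dotProduct a₂ x
  have h₃ := hasFDerivAt_dotProduct a₃ x
  have key := ((((h₂.const_mul a).mul h₃).mul_const ((J *ᵥ a₁) i)).add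
    (((h₁.const_mul b).mul h₃).mul_const ((J *ᵥ a₂) i))).add
    (((h₁.const_mul c).mul h₂).mul_const ((J *ᵥ a₃) i))
  have hcol : ∀ k, (J * (of ![a₁, a₂, a₃])ᵀ) i k = (J *ᵥ (![a₁, a₂, a₃] k)) i :=
    fun k => rfl
  rw [jacobian, of_apply]
  simp only [mulVec_add, mulVec_smul, Pi.add_apply, Pi.smul_apply, smul_eq_mul]
  refine (congrArg (fun L => L (Pi.single j 1)) key.fderiv).trans ?_
  simp [Matrix.mul_apply (M := _ * _) (N := of _),
    hcol, Fin.sum_univ_three, nahmHessian, mulVec, dotProduct_single]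
  ring

theorem dotProduct_mulVec_skew {n : ℕ} {J : Matrix (Fin n) (Fin n) ℝ} (hJ : Jᵀ = -J)
    (u v : Fin n → ℝ) : u ⬝ᵥ J *ᵥ v = -(v ⬝ᵥ J *ᵥ u) := by
  rw [dotProduct_mulVec, ← mulVec_transpose, hJ, neg_mulVec, neg_dotProduct, dotProduct_comm]

theorem det_skew_mul_nahmHessian (a b c p q r : ℝ) (y z : Fin 3 → ℝ)
    (h₁ : z 0 - y 0 = p * (b * (y 0 * z 2 + z 0 * y 2)) + q * (c * (y 0 * z 1 + z 0 * y 1)))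
    (h₂ : z 1 - y 1 = -p * (a * (y 1 * z 2 + z 1 * y 2)) + r * (c * (y 0 * z 1 + z 0 * y 1)))
    (h₃ : z 2 - y 2 = -q * (a * (y 1 * z 2 + z 1 * y 2)) - r * (b * (y 0 * z 2 + z 0 * y 2))) :
    (1 + !![0, p, q; -p, 0, r; -q, -r, 0] * nahmHessian a b c z).det * (y 0 * y 1 * y 2) =
      (1 - !![0, p, q; -p, 0, r; -q, -r, 0] * nahmHessian a b c y).det *
        (z 0 * z 1 * z 2) := by
  simp only [nahmHessian, mul_fin_three, one_fin_three, det_fin_three, Matrix.add_apply,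
    Matrix.sub_apply, of_apply, cons_val]
  generalize y 0 = y₁, y 1 = y₂, y 2 = y₃, z 0 = z₁, z 1 = z₂, z 2 = z₃ at *
  grind

/-- for the vector field `f(x) = J(a ℓ₂ℓ₃ a₁ + b ℓ₁ℓ₃ a₂ + c ℓ₁ℓ₂ a₃)`
(with `ℓᵢ(x) = aᵢᵀx` linear forms, `J` skew-symmetric), any `x, x̃` satisfying the
Kahan–Hirota–Kimura relation fulfil
`det(I + ε f'(x̃)) ℓ₁(x)ℓ₂(x)ℓ₃(x) = det(I − ε f'(x)) ℓ₁(x̃)ℓ₂(x̃)ℓ₃(x̃)`,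
so that the KHK map preserves the measure form `dx₁∧…∧dxₙ/(ℓ₁ℓ₂ℓ₃)`. -/
theorem khk_nahm_measure (n : ℕ) (a₁ a₂ a₃ : Fin n → ℝ)
    (J : Matrix (Fin n) (Fin n) ℝ) (hJ : Jᵀ = -J) (a b c : ℝ)
    (f : (Fin n → ℝ) → (Fin n → ℝ))
    (hf : f = fun x => J *ᵥ ((a * (a₂ ⬝ᵥ x) * (a₃ ⬝ᵥ x)) • a₁ +
      (b * (a₁ ⬝ᵥ x) * (a₃ ⬝ᵥ x)) • a₂ + (c * (a₁ ⬝ᵥ x) * (a₂ ⬝ᵥ x)) • a₃))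
    (ε : ℝ) (x x' : Fin n → ℝ)
    (hkhk : x' - x = ε • (J *ᵥ
      ((a * ((a₂ ⬝ᵥ x) * (a₃ ⬝ᵥ x') + (a₂ ⬝ᵥ x') * (a₃ ⬝ᵥ x))) • a₁ +
       (b * ((a₁ ⬝ᵥ x) * (a₃ ⬝ᵥ x') + (a₁ ⬝ᵥ x') * (a₃ ⬝ᵥ x))) • a₂ +
       (c * ((a₁ ⬝ᵥ x) * (a₂ ⬝ᵥ x') + (a₁ ⬝ᵥ x') * (a₂ ⬝ᵥ x))) • a₃))) :
    (1 + ε • jacobian f x').det * ((a₁ ⬝ᵥ x) * (a₂ ⬝ᵥ x) * (a₃ ⬝ᵥ x)) =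
      (1 - ε • jacobian f x).det * ((a₁ ⬝ᵥ x') * (a₂ ⬝ᵥ x') * (a₃ ⬝ᵥ x')) := by
  set A : Matrix (Fin 3) (Fin n) ℝ := of ![a₁, a₂, a₃] with hA
  have hskew := dotProduct_mulVec_skew hJ
  have hdiag (u : Fin n → ℝ) : u ⬝ᵥ J *ᵥ u = 0 := by linarith [hskew u u]
  have hS : ε • (A * J * Aᵀ) = !![0, ε * (a₁ ⬝ᵥ J *ᵥ a₂), ε * (a₁ ⬝ᵥ J *ᵥ a₃);
      -(ε * (a₁ ⬝ᵥ J *ᵥ a₂)), 0, ε * (a₂ ⬝ᵥ J *ᵥ a₃);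
      -(ε * (a₁ ⬝ᵥ J *ᵥ a₃)), -(ε * (a₂ ⬝ᵥ J *ᵥ a₃)), 0] := by
    have hentry (i j : Fin 3) : (A * J * Aᵀ) i j = ![a₁, a₂, a₃] i ⬝ᵥ J *ᵥ ![a₁, a₂, a₃] j := by
      rw [Matrix.mul_assoc]
      rfl
    ext i j
    rw [Matrix.smul_apply, hentry]
    fin_cases i <;> fin_cases j <;>
      simp [hdiag, hskew a₂ a₁, hskew a₃ a₁, hskew a₃ a₂]
  have hJac (y : Fin n → ℝ) :
      ε • jacobian f y = (ε • (J * Aᵀ * nahmHessian a b c (A *ᵥ y))) * A := by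
    rw [hf, jacobian_nahm, smul_mul]
  have hmul (y : Fin n → ℝ) : A * (ε • (J * Aᵀ * nahmHessian a b c (A *ᵥ y))) =
      (ε • (A * J * Aᵀ)) * nahmHessian a b c (A *ᵥ y) := by
    simp only [Matrix.mul_smul, Matrix.smul_mul, Matrix.mul_assoc]
  have hdot (u : Fin n → ℝ) := congrArg (u ⬝ᵥ ·) hkhk
  simp only [dotProduct_sub, dotProduct_smul, mulVec_add, mulVec_smul, dotProduct_add,
    smul_eq_mul] at hdot
  have h₁ := hdot a₁
  have h₂ := hdot a₂
  have h₃ := hdot a₃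
  rw [hdiag] at h₁ h₂ h₃
  rw [hskew a₂ a₁] at h₂
  rw [hskew a₃ a₁, hskew a₃ a₂] at h₃
  rw [hJac, hJac, det_one_add_mul_comm, det_one_sub_mul_comm, hmul, hmul, hS]
  refine det_skew_mul_nahmHessian a b c _ _ _ (A *ᵥ x) (A *ᵥ x') ?_ ?_ ?_
  · change a₁ ⬝ᵥ x' - a₁ ⬝ᵥ x = _
    exact h₁.trans (by simp [hA, mulVec]; ring)
  · exact h₂.trans (by simp [hA, mulVec]; ring)
  · exact h₃.trans (by simp [hA, mulVec]; ring)
end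

section
/- Let ℓ₁,ℓ₂ be linear forms on ℝⁿ with ℓᵢ(x)=aᵢᵀx, let J be a skew-symmetric real n×n matrix, α,β∈ℝ, and set a₃=αa₁+βa₂, ℓ₃=αℓ₁+βℓ₂, λ=a₁ᵀJa₂. Consider the vector field f(x)=J( ℓ₂ℓ₃ a₁ + 2 ℓ₁ℓ₃ a₂ + 3 ℓ₁ℓ₂ a₃ ), whose Kahan–Hirota–Kimura discretization reads x̃−x = εJ( (4α(ℓ₁ℓ̃₂+ℓ̃₁ℓ₂)+2βℓ₂ℓ̃₂) a₁ + (5β(ℓ₁ℓ̃₂+ℓ̃₁ℓ₂)+4αℓ₁ℓ̃₁) a₂ ), with ℓ̃ᵢ=ℓᵢ(x̃). Then the map admits the conserved quantity H_ε = H/(1+ε²P₂+ε⁴P₄+ε⁶P₆), where H=ℓ₁ℓ₂²ℓ₃³, P₂=−λ²(32α²ℓ₁²+40αβℓ₁ℓ₂+35β²ℓ₂²), P₄=λ⁴(256α⁴ℓ₁⁴+640α³βℓ₁³ℓ₂+960α²β²ℓ₁²ℓ₂²+592αβ³ℓ₁ℓ₂³+259β⁴ℓ₂⁴), and P₆=−λ⁶(−1152α³β³ℓ₁³ℓ₂³−864α²β⁴ℓ₁²ℓ₂⁴−216αβ⁵ℓ₁ℓ₂⁵+225β⁶ℓ₂⁶).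 Precisely, for any x,x̃ satisfying the discretization relation, H(x̃)·(1+ε²P₂(x)+ε⁴P₄(x)+ε⁶P₆(x)) = H(x)·(1+ε²P₂(x̃)+ε⁴P₄(x̃)+ε⁶P₆(x̃)). -/
open Matrix

/-- The common denominator `1 + ε²P₂ + ε⁴P₄ + ε⁶P₆` in the scaled variables
`A = ελαℓ₁`, `B = ελβℓ₂`, homogenized to degree six by `D`. -/
def khkDenominator (D A B : ℝ) : ℝ :=
  D ^ 6 - D ^ 4 * (32 * A ^ 2 + 40 * A * B + 35 * B ^ 2) +
    D ^ 2 * (256 * A ^ 4 + 640 * A ^ 3 * B + 960 * A ^ 2 * B ^ 2 + 592 * A * B ^ 3 +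
      259 * B ^ 4) -
    (-1152 * A ^ 3 * B ^ 3 - 864 * A ^ 2 * B ^ 4 - 216 * A * B ^ 5 + 225 * B ^ 6)

lemma khkDenominator_smul (c D A B : ℝ) :
    khkDenominator (c * D) (c * A) (c * B) = c ^ 6 * khkDenominator D A B := by
  unfold khkDenominator; ring

lemma khkDenominator_map (A B : ℝ) :
    khkDenominator ((1 - 4 * A - 5 * B) * (1 + 4 * A + 2 * B) + 20 * A * B)
        (A * (1 + 4 * A + 7 * B)) (B * (1 - 8 * A - 5 * B)) =
      (1 + 4 * A + 7 * B) * (1 - 8 * A - 5 * B) ^ 2 * (1 + 4 * A - 5 * B) ^ 3 *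
        khkDenominator 1 A B := by
  unfold khkDenominator; ring

/-- Conservation for the planar map satisfied by the values `u, v` of `ℓ₁, ℓ₂` and their
images `U, V`. The hypotheses are linear in `(U, V)`; when their determinant vanishes, both the
numerator and the denominator of the conserved quantity vanish at `(u, v)`. -/
lemma khk_planar_conserved (α β e u v U V : ℝ)
    (hU : U - u = e * (5 * β * (u * V + U * v) + 4 * α * u * U))
    (hV : V - v = -e * (4 * α * (u * V + U * v) + 2 * β * v * V)) :
    U * V ^ 2 * (α * U + β * V) ^ 3 * khkDenominator 1 (e * α * u) (e * β * v) =
      u * v ^ 2 * (α * u + β * v) ^ 3 * khkDenominator 1 (e * α * U) (e * β * V) := by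
  obtain ⟨A, hA⟩ : ∃ A, A = e * α * u := ⟨_, rfl⟩
  obtain ⟨B, hB⟩ : ∃ B, B = e * β * v := ⟨_, rfl⟩
  obtain ⟨D, hD⟩ : ∃ D, D = (1 - 4 * A - 5 * B) * (1 + 4 * A + 2 * B) + 20 * A * B := ⟨_, rfl⟩
  have hDU : D * U = u * (1 + 4 * A + 7 * B) := by
    subst hA hB hD
    linear_combination (1 + 4 * (e * α * u) + 2 * (e * β * v)) * hU + 5 * e * β * u * hV
  have hDV : D * V = v * (1 - 8 * A - 5 * B) := by
    subst hA hB hD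
    linear_combination (1 - 4 * (e * α * u) - 5 * (e * β * v)) * hV - 4 * e * α * v * hU
  rw [← hA, ← hB]
  rcases eq_or_ne D 0 with h0 | h0
  · rw [h0, zero_mul] at hDU hDV
    suffices h : u * v ^ 2 * (α * u + β * v) ^ 3 = 0 ∧ khkDenominator 1 A B = 0 by
      rw [h.1, h.2]; ring
    rcases mul_eq_zero.1 hDU.symm with hu | hu
    · refine ⟨by rw [hu]; ring, ?_⟩
      have hA0 : A = 0 := by rw [hA, hu, mul_zero]
      rcases mul_eq_zero.1 hDV.symm with hv | hv
      · have hB0 : B = 0 := by rw [hB, hv, mul_zero]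
        rw [h0, hA0, hB0] at hD
        norm_num at hD
      · have hB5 : B = 1 / 5 := by linarith
        rw [hA0, hB5]; norm_num [khkDenominator]
    · rcases mul_eq_zero.1 hDV.symm with hv | hv
      · refine ⟨by rw [hv]; ring, ?_⟩
        have hB0 : B = 0 := by rw [hB, hv, mul_zero]
        have hA4 : A = -1 / 4 := by linarith
        rw [hA4, hB0]; norm_num [khkDenominator]
      · have hB3 : B = -1 / 3 := by linarith
        have hA3 : A = 1 / 3 := by linarith
        refine ⟨?_, by rw [hA3, hB3]; norm_num [khkDenominator]⟩
        have he : e ≠ 0 := by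
          rintro rfl
          norm_num [hA3] at hA
        have hsum : α * u + β * v = 0 :=
          (mul_eq_zero.1 (by linarith : e * (α * u + β * v) = 0)).resolve_left he
        rw [hsum]; ring
  · have hDL : D * (α * U + β * V) = (α * u + β * v) * (1 + 4 * A - 5 * B) := by
      subst hA hB
      linear_combination α * hDU + β * hDV
    have hQ : D ^ 6 * khkDenominator 1 (e * α * U) (e * β * V) =
        (1 + 4 * A + 7 * B) * (1 - 8 * A - 5 * B) ^ 2 * (1 + 4 * A - 5 * B) ^ 3 *
          khkDenominator 1 A B := by
      rw [← khkDenominator_smul, ← khkDenominator_map, ← hD, mul_one]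
      congr 1
      · linear_combination e * α * hDU - (1 + 4 * A + 7 * B) * hA
      · linear_combination e * β * hDV - (1 - 8 * A - 5 * B) * hB
    apply mul_left_cancel₀ (pow_ne_zero 6 h0)
    calc D ^ 6 * (U * V ^ 2 * (α * U + β * V) ^ 3 * khkDenominator 1 A B)
        = (D * U) * (D * V) ^ 2 * (D * (α * U + β * V)) ^ 3 * khkDenominator 1 A B := by ring
      _ = u * v ^ 2 * (α * u + β * v) ^ 3 *
          (D ^ 6 * khkDenominator 1 (e * α * U) (e * β * V)) := by
        rw [hDU, hDV, hDL, hQ]; ring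
      _ = _ := by ring

lemma dotProduct_mulVec_comm_of_transpose_eq_neg {n : ℕ} {J : Matrix (Fin n) (Fin n) ℝ}
    (hJ : Jᵀ = -J) (a b : Fin n → ℝ) : a ⬝ᵥ (J *ᵥ b) = -(b ⬝ᵥ (J *ᵥ a)) := by
  rw [dotProduct_mulVec, ← mulVec_transpose, hJ, neg_mulVec, neg_dotProduct, dotProduct_comm]

/-- conserved quantity of the Kahan–Hirota–Kimura discretization of
the system with exponents `(a,b,c) = (1,2,3)` and `ℓ₃ = αℓ₁ + βℓ₂`:
for `H = ℓ₁ℓ₂²ℓ₃³`, `λ = a₁ᵀJa₂` and `P₂, P₄, P₆` as given, the quantity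
`H_ε = H/(1 + ε²P₂ + ε⁴P₄ + ε⁶P₆)` is conserved, i.e.
`H(x̃)(1 + ε²P₂(x) + ε⁴P₄(x) + ε⁶P₆(x)) = H(x)(1 + ε²P₂(x̃) + ε⁴P₄(x̃) + ε⁶P₆(x̃))`. -/
theorem khk_nahm_123_conserved (n : ℕ) (a₁ a₂ : Fin n → ℝ)
    (J : Matrix (Fin n) (Fin n) ℝ) (hJ : Jᵀ = -J) (α β : ℝ)
    (a₃ : Fin n → ℝ) (ha₃ : a₃ = α • a₁ + β • a₂)
    (lam : ℝ) (hlam : lam = a₁ ⬝ᵥ (J *ᵥ a₂))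
    (ℓ₁ ℓ₂ ℓ₃ : (Fin n → ℝ) → ℝ)
    (hℓ₁ : ℓ₁ = fun x => a₁ ⬝ᵥ x) (hℓ₂ : ℓ₂ = fun x => a₂ ⬝ᵥ x)
    (hℓ₃ : ℓ₃ = fun x => a₃ ⬝ᵥ x)
    (H : (Fin n → ℝ) → ℝ) (hH : H = fun x => ℓ₁ x * (ℓ₂ x) ^ 2 * (ℓ₃ x) ^ 3)
    (P₂ P₄ P₆ : (Fin n → ℝ) → ℝ)
    (hP₂ : P₂ = fun x => -lam ^ 2 *
      (32 * α ^ 2 * (ℓ₁ x) ^ 2 + 40 * α * β * ℓ₁ x * ℓ₂ x + 35 * β ^ 2 * (ℓ₂ x) ^ 2))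
    (hP₄ : P₄ = fun x => lam ^ 4 *
      (256 * α ^ 4 * (ℓ₁ x) ^ 4 + 640 * α ^ 3 * β * (ℓ₁ x) ^ 3 * ℓ₂ x +
       960 * α ^ 2 * β ^ 2 * (ℓ₁ x) ^ 2 * (ℓ₂ x) ^ 2 +
       592 * α * β ^ 3 * ℓ₁ x * (ℓ₂ x) ^ 3 + 259 * β ^ 4 * (ℓ₂ x) ^ 4))
    (hP₆ : P₆ = fun x => -lam ^ 6 *
      (-1152 * α ^ 3 * β ^ 3 * (ℓ₁ x) ^ 3 * (ℓ₂ x) ^ 3 -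
       864 * α ^ 2 * β ^ 4 * (ℓ₁ x) ^ 2 * (ℓ₂ x) ^ 4 -
       216 * α * β ^ 5 * ℓ₁ x * (ℓ₂ x) ^ 5 + 225 * β ^ 6 * (ℓ₂ x) ^ 6))
    (ε : ℝ) (x x' : Fin n → ℝ)
    (hkhk : x' - x = ε • (J *ᵥ
      ((4 * α * (ℓ₁ x * ℓ₂ x' + ℓ₁ x' * ℓ₂ x) + 2 * β * ℓ₂ x * ℓ₂ x') • a₁ +
       (5 * β * (ℓ₁ x * ℓ₂ x' + ℓ₁ x' * ℓ₂ x) + 4 * α * ℓ₁ x * ℓ₁ x') • a₂))) :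
    H x' * (1 + ε ^ 2 * P₂ x + ε ^ 4 * P₄ x + ε ^ 6 * P₆ x) =
      H x * (1 + ε ^ 2 * P₂ x' + ε ^ 4 * P₄ x' + ε ^ 6 * P₆ x') := by
  have h11 : a₁ ⬝ᵥ (J *ᵥ a₁) = 0 := by
    linarith [dotProduct_mulVec_comm_of_transpose_eq_neg hJ a₁ a₁]
  have h22 : a₂ ⬝ᵥ (J *ᵥ a₂) = 0 := by
    linarith [dotProduct_mulVec_comm_of_transpose_eq_neg hJ a₂ a₂]
  have h21 : a₂ ⬝ᵥ (J *ᵥ a₁) = -lam := by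
    rw [dotProduct_mulVec_comm_of_transpose_eq_neg hJ, hlam]
  have hL (y) : ℓ₃ y = α * ℓ₁ y + β * ℓ₂ y := by
    simp only [hℓ₁, hℓ₂, hℓ₃, ha₃, add_dotProduct, smul_dotProduct, smul_eq_mul]
  have h1 : ℓ₁ x' - ℓ₁ x = a₁ ⬝ᵥ (x' - x) := by simp only [hℓ₁, dotProduct_sub]
  have h2 : ℓ₂ x' - ℓ₂ x = a₂ ⬝ᵥ (x' - x) := by simp only [hℓ₂, dotProduct_sub]
  rw [hkhk] at h1 h2
  simp only [dotProduct_smul, mulVec_add, mulVec_smul, dotProduct_add, smul_eq_mul,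
    h11, h22, h21, ← hlam] at h1 h2
  have key := khk_planar_conserved α β (ε * lam) (ℓ₁ x) (ℓ₂ x) (ℓ₁ x') (ℓ₂ x')
    (by linear_combination h1) (by linear_combination h2)
  have hQ (y) : 1 + ε ^ 2 * P₂ y + ε ^ 4 * P₄ y + ε ^ 6 * P₆ y =
      khkDenominator 1 (ε * lam * α * ℓ₁ y) (ε * lam * β * ℓ₂ y) := by
    simp only [hP₂, hP₄, hP₆, khkDenominator]
    ring
  rw [hQ, hQ]
  simp only [hH, hL]
  exact key
end

section
/- Let n≥3, let ℓ₁,ℓ₂,ℓ₃,ℓ₄ be linear forms on ℝⁿ with ℓᵢ(x)=aᵢᵀx, and let v₁,…,v_{n−3}∈ℝⁿ. For indices i,j,k set Δ_{ijk}=det(aᵢ,v₁,…,v_{n−3},aⱼ,a_k). Suppose x,x̃∈ℝⁿ satisfy the Kahan–Hirota–Kimura relation of the vector field with wᵀf(x)=det(w,v₁,…,v_{n−3}, ℓ₂a₁+ℓ₁a₂, ℓ₄a₃+ℓ₃a₄), namely for all w∈ℝⁿ: wᵀ(x̃−x)/ε = (ℓ₁ℓ̃₃+ℓ̃₁ℓ₃)wᵀΔ₂₄ᵛ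 + (ℓ₁ℓ̃₄+ℓ̃₁ℓ₄)wᵀΔ₂₃ᵛ + (ℓ₂ℓ̃₃+ℓ̃₂ℓ₃)wᵀΔ₁₄ᵛ + (ℓ₂ℓ̃₄+ℓ̃₂ℓ₄)wᵀΔ₁₃ᵛ, where Δᵢⱼᵛ∈ℝⁿ is defined by wᵀΔᵢⱼᵛ=det(w,v₁,…,v_{n−3},aᵢ,aⱼ) and ℓ̃ᵢ=ℓᵢ(x̃). Then ℓ₁(x̃)ℓ₂(x̃)·(1−ε²(ℓ₃(x)Δ₁₂₄+ℓ₄(x)Δ₁₂₃)²) = ℓ₁(x)ℓ₂(x)·(1−ε²(ℓ₃(x̃)Δ₁₂₄+ℓ₄(x̃)Δ₁₂₃)²) and ℓ₃(x̃)ℓ₄(x̃)·(1−ε²(ℓ₁(x)Δ₂₃₄+ℓ₂(x)Δ₁₃₄)²) = ℓ₃(x)ℓ₄(x)·(1−ε²(ℓ₁(x̃)Δ₂₃₄+ℓ₂(x̃)Δ₁₃₄)²); i.e. H_ε=ℓ₁ℓ₂/(1−ε²(ℓ₃Δ₁₂₄+ℓ₄Δ₁₂₃)²) and K_ε=ℓ₃ℓ₄/(1−ε²(ℓ₁Δ₂₃₄+ℓ₂Δ₁₃₄)²)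 are conserved quantities of the Kahan–Hirota–Kimura map. Moreover vᵢᵀx̃=vᵢᵀx for i=1,…,n−3. -/
open Matrix

/-- `colDet w v u₁ u₂` is the determinant of the `n×n` matrix (`n = m+3`) whose
columns are `w, v 0, …, v (m−1), u₁, u₂`, in this order. -/
def colDet {m : ℕ} (w : Fin (m + 3) → ℝ) (v : Fin m → Fin (m + 3) → ℝ)
    (u₁ u₂ : Fin (m + 3) → ℝ) : ℝ :=
  Matrix.det (Matrix.of fun i j =>
    (Fin.cons w (Fin.snoc (Fin.snoc v u₁) u₂) : Fin (m + 3) → Fin (m + 3) → ℝ) j i)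

theorem colDet_eq_detRowAlternating {m : ℕ} (w : Fin (m + 3) → ℝ) (v : Fin m → Fin (m + 3) → ℝ)
    (u₁ u₂ : Fin (m + 3) → ℝ) :
    colDet w v u₁ u₂ = Matrix.detRowAlternating
      (Fin.cons w (Fin.snoc (Fin.snoc v u₁) u₂) : Fin (m + 3) → Fin (m + 3) → ℝ) :=
  Matrix.det_transpose _

theorem colDet_swap_right {m : ℕ} (w : Fin (m + 3) → ℝ) (v : Fin m → Fin (m + 3) → ℝ)
    (u₁ u₂ : Fin (m + 3) → ℝ) : colDet w v u₂ u₁ = -colDet w v u₁ u₂ := by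
  have hne : (Fin.last m).castSucc.succ ≠ (Fin.last (m + 1)).succ := by
    simp [Fin.ext_iff]
  rw [colDet_eq_detRowAlternating, colDet_eq_detRowAlternating,
    ← AlternatingMap.map_swap _ _ hne]
  congr 1
  funext j
  refine Fin.cases ?_ (fun j => ?_) j
  · rw [Function.comp_apply, Equiv.swap_apply_of_ne_of_ne (Fin.succ_ne_zero _).symm
      (Fin.succ_ne_zero _).symm]
    rfl
  refine Fin.lastCases ?_ (fun j => ?_) j
  · simp
  refine Fin.lastCases ?_ (fun j => ?_) j
  · simp
  · rw [Function.comp_apply, Equiv.swap_apply_of_ne_of_ne]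
    · simp
    · simpa [Fin.ext_iff] using j.isLt.ne
    · simp only [ne_eq, Fin.ext_iff, Fin.val_succ, Fin.val_castSucc, Fin.val_last]
      omega

theorem colDet_swap_left {m : ℕ} (w : Fin (m + 3) → ℝ) (v : Fin m → Fin (m + 3) → ℝ)
    (u₁ u₂ : Fin (m + 3) → ℝ) : colDet u₁ v w u₂ = -colDet w v u₁ u₂ := by
  have hne : (0 : Fin (m + 3)) ≠ (Fin.last m).castSucc.succ := (Fin.succ_ne_zero _).symm
  rw [colDet_eq_detRowAlternating, colDet_eq_detRowAlternating,
    ← AlternatingMap.map_swap _ _ hne]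
  congr 1
  funext j
  refine Fin.cases ?_ (fun j => ?_) j
  · simp
  refine Fin.lastCases ?_ (fun j => ?_) j
  · rw [Function.comp_apply, Equiv.swap_apply_of_ne_of_ne (Fin.succ_ne_zero _)]
    · simp
    · simp [Fin.ext_iff]
  refine Fin.lastCases ?_ (fun j => ?_) j
  · simp
  · rw [Function.comp_apply, Equiv.swap_apply_of_ne_of_ne (Fin.succ_ne_zero _)]
    · simp
    · simpa [Fin.ext_iff] using j.isLt.ne

theorem colDet_self_left {m : ℕ} (w : Fin (m + 3) → ℝ) (v : Fin m → Fin (m + 3) → ℝ)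
    (u : Fin (m + 3) → ℝ) : colDet w v w u = 0 := by
  linarith [colDet_swap_left w v w u]

theorem colDet_self_outer {m : ℕ} (w : Fin (m + 3) → ℝ) (v : Fin m → Fin (m + 3) → ℝ)
    (u : Fin (m + 3) → ℝ) : colDet w v u w = 0 := by
  rw [colDet_swap_right, colDet_self_left, neg_zero]

theorem colDet_param_eq_zero {m : ℕ} (v : Fin m → Fin (m + 3) → ℝ) (i : Fin m)
    (u₁ u₂ : Fin (m + 3) → ℝ) : colDet (v i) v u₁ u₂ = 0 := by
  rw [colDet_eq_detRowAlternating]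
  refine AlternatingMap.map_eq_zero_of_eq _ _ (i := 0) (j := i.castSucc.castSucc.succ) ?_
    (Fin.succ_ne_zero _).symm
  simp

/-- for the Kahan–Hirota–Kimura discretization of the Nambu-type
system with `H = ℓ₁ℓ₂`, `K = ℓ₃ℓ₄` products of linear forms, setting
`Δ_{ijk} = det(aᵢ, v₁,…,v_{n−3}, aⱼ, a_k)`, the quantities
`H_ε = ℓ₁ℓ₂/(1−ε²(ℓ₃Δ₁₂₄+ℓ₄Δ₁₂₃)²)` and `K_ε = ℓ₃ℓ₄/(1−ε²(ℓ₁Δ₂₃₄+ℓ₂Δ₁₃₄)²)` are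
conserved, and all linear integrals `vᵢᵀx` are preserved. -/
theorem khk_nambu_split_HK (m : ℕ) (a₁ a₂ a₃ a₄ : Fin (m + 3) → ℝ)
    (v : Fin m → Fin (m + 3) → ℝ)
    (ℓ₁ ℓ₂ ℓ₃ ℓ₄ : (Fin (m + 3) → ℝ) → ℝ)
    (hℓ₁ : ℓ₁ = fun x => a₁ ⬝ᵥ x) (hℓ₂ : ℓ₂ = fun x => a₂ ⬝ᵥ x)
    (hℓ₃ : ℓ₃ = fun x => a₃ ⬝ᵥ x) (hℓ₄ : ℓ₄ = fun x => a₄ ⬝ᵥ x)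
    (Δ₁₂₄ Δ₁₂₃ Δ₂₃₄ Δ₁₃₄ : ℝ)
    (hΔ₁₂₄ : Δ₁₂₄ = colDet a₁ v a₂ a₄) (hΔ₁₂₃ : Δ₁₂₃ = colDet a₁ v a₂ a₃)
    (hΔ₂₃₄ : Δ₂₃₄ = colDet a₂ v a₃ a₄) (hΔ₁₃₄ : Δ₁₃₄ = colDet a₁ v a₃ a₄)
    (ε : ℝ) (x x' : Fin (m + 3) → ℝ)
    (hkhk : ∀ w : Fin (m + 3) → ℝ, w ⬝ᵥ (x' - x) =
      ε * ((ℓ₁ x * ℓ₃ x' + ℓ₁ x' * ℓ₃ x) * colDet w v a₂ a₄ +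
           (ℓ₁ x * ℓ₄ x' + ℓ₁ x' * ℓ₄ x) * colDet w v a₂ a₃ +
           (ℓ₂ x * ℓ₃ x' + ℓ₂ x' * ℓ₃ x) * colDet w v a₁ a₄ +
           (ℓ₂ x * ℓ₄ x' + ℓ₂ x' * ℓ₄ x) * colDet w v a₁ a₃)) :
    ℓ₁ x' * ℓ₂ x' * (1 - ε ^ 2 * (ℓ₃ x * Δ₁₂₄ + ℓ₄ x * Δ₁₂₃) ^ 2) =
      ℓ₁ x * ℓ₂ x * (1 - ε ^ 2 * (ℓ₃ x' * Δ₁₂₄ + ℓ₄ x' * Δ₁₂₃) ^ 2) ∧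
    ℓ₃ x' * ℓ₄ x' * (1 - ε ^ 2 * (ℓ₁ x * Δ₂₃₄ + ℓ₂ x * Δ₁₃₄) ^ 2) =
      ℓ₃ x * ℓ₄ x * (1 - ε ^ 2 * (ℓ₁ x' * Δ₂₃₄ + ℓ₂ x' * Δ₁₃₄) ^ 2) ∧
    (∀ i, v i ⬝ᵥ x' = v i ⬝ᵥ x) := by
  have expand := fun w : Fin (m + 3) → ℝ => (dotProduct_sub w x' x).symm.trans (hkhk w)
  have e₁ := expand a₁
  have e₂ := expand a₂
  have e₃ := expand a₃
  have e₄ := expand a₄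
  simp only [colDet_self_left, colDet_self_outer] at e₁ e₂ e₃ e₄
  rw [← hΔ₁₂₄, ← hΔ₁₂₃] at e₁
  rw [colDet_swap_left a₁ v a₂ a₄, colDet_swap_left a₁ v a₂ a₃, ← hΔ₁₂₄, ← hΔ₁₂₃] at e₂
  rw [colDet_swap_left a₂ v a₃ a₄, colDet_swap_left a₁ v a₃ a₄, ← hΔ₂₃₄, ← hΔ₁₃₄] at e₃
  rw [colDet_swap_left a₂ v a₄ a₃, colDet_swap_right a₂ v a₃ a₄,
    colDet_swap_left a₁ v a₄ a₃, colDet_swap_right a₁ v a₃ a₄, ← hΔ₂₃₄, ← hΔ₁₃₄] at e₄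
  have f₁ : ℓ₁ x' * (1 - ε * (ℓ₃ x * Δ₁₂₄ + ℓ₄ x * Δ₁₂₃)) =
      ℓ₁ x * (1 + ε * (ℓ₃ x' * Δ₁₂₄ + ℓ₄ x' * Δ₁₂₃)) := by
    rw [← congrFun hℓ₁ x', ← congrFun hℓ₁ x] at e₁
    linear_combination e₁
  have f₂ : ℓ₂ x' * (1 + ε * (ℓ₃ x * Δ₁₂₄ + ℓ₄ x * Δ₁₂₃)) =
      ℓ₂ x * (1 - ε * (ℓ₃ x' * Δ₁₂₄ + ℓ₄ x' * Δ₁₂₃)) := by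
    rw [← congrFun hℓ₂ x', ← congrFun hℓ₂ x] at e₂
    linear_combination e₂
  have f₃ : ℓ₃ x' * (1 + ε * (ℓ₁ x * Δ₂₃₄ + ℓ₂ x * Δ₁₃₄)) =
      ℓ₃ x * (1 - ε * (ℓ₁ x' * Δ₂₃₄ + ℓ₂ x' * Δ₁₃₄)) := by
    rw [← congrFun hℓ₃ x', ← congrFun hℓ₃ x] at e₃
    linear_combination e₃
  have f₄ : ℓ₄ x' * (1 - ε * (ℓ₁ x * Δ₂₃₄ + ℓ₂ x * Δ₁₃₄)) =
      ℓ₄ x * (1 + ε * (ℓ₁ x' * Δ₂₃₄ + ℓ₂ x' * Δ₁₃₄)) := by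
    rw [← congrFun hℓ₄ x', ← congrFun hℓ₄ x] at e₄
    linear_combination e₄
  refine ⟨?_, ?_, fun i => ?_⟩
  · linear_combination congrArg₂ (· * ·) f₁ f₂
  · linear_combination congrArg₂ (· * ·) f₃ f₄
  · have h := expand (v i)
    simp only [colDet_param_eq_zero, mul_zero, add_zero] at h
    exact sub_eq_zero.mp h
end
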